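/- arXiv:2201.09129 — 4 statements merged into one kernel-verified Lean document; each statement's English description precedes it below -/
import Mathlib

section
/- Let G be a finite group and let A be a module over the group ring ℤ[G] whose underlying additive group is finite. Then A is generated by k elements as a ℤ[G]-module if and only if, for every prime p dividing |A|, the p-primary component A_p (the Sylow p-subgroup of the underlying finite abelian group, which is a ℤ[G]-submodule) is generated by k elements as a ℤ[G]-module. -/
/-- The `p`-primary component as a submodule. -/
def primaryPart {R A : Type*} [Ring R] [AddCommGroup A] [Module R A] (p : ℕ) :
    Submodule R A where
  carrier := {a : A | ∃ n : ℕ, p ^ n • a = 0}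
  zero_mem' := ⟨0, by simp⟩
  add_mem' := by
    rintro a b ⟨n, hn⟩ ⟨m, hm⟩
    refine ⟨n + m, ?_⟩
    rw [smul_add, pow_add, mul_comm, mul_smul, hn, mul_comm, mul_smul, hm]
    simp
  smul_mem' := by
    rintro r a ⟨n, hn⟩
    exact ⟨n, by rw [smul_comm, hn, smul_zero]⟩

theorem mem_of_coprime_smul {R A : Type*} [Ring R] [AddCommGroup A] [Module R A]
    (S : Submodule R A) (a : A) (m n : ℕ) (h : Nat.Coprime m n) (hm : m • a ∈ S)
    (hn : n • a ∈ S) : a ∈ S := by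
  have key : ∀ j : ℕ, j • a ∈ S → addOrderOf (S.mkQ a) ∣ j := by
    intro j hj
    apply addOrderOf_dvd_of_nsmul_eq_zero
    rw [← map_nsmul]
    exact (Submodule.Quotient.mk_eq_zero S).2 hj
  have h1 := Nat.eq_one_of_dvd_coprimes h (key m hm) (key n hn)
  rw [AddMonoid.addOrderOf_eq_one_iff] at h1
  simpa using h1

theorem kgen_forward {R A : Type*} [Ring R] [AddCommGroup A] [Finite A] [Module R A] (k : ℕ)
    (f : Fin k → A) (hf : Submodule.span R (Set.range f) = ⊤) (p : ℕ) (hp : p.Prime)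
    (P : Submodule R A) (hP : (P : Set A) = {a : A | ∃ n : ℕ, p ^ n • a = 0}) :
    ∃ f : Fin k → A, Submodule.span R (Set.range f) = P := by
  have hN : Nat.card A ≠ 0 := Nat.card_pos.ne'
  have hmem : ∀ a, a ∈ P ↔ ∃ n : ℕ, p ^ n • a = 0 := fun a => by
    rw [← SetLike.mem_coe, hP]; rfl
  set m := ordCompl[p] (Nat.card A) with hm
  refine ⟨fun i => m • f i, le_antisymm ?_ ?_⟩
  · rw [Submodule.span_le]
    rintro _ ⟨i, rfl⟩
    refine (hmem _).2 ⟨(Nat.card A).factorization p, ?_⟩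
    rw [← mul_smul, hm, Nat.ordProj_mul_ordCompl_eq_self]
    exact card_nsmul_eq_zero'
  · intro a ha
    obtain ⟨n, hn⟩ := (hmem a).1 ha
    have hc : Nat.Coprime m (p ^ n) :=
      ((Nat.coprime_ordCompl hp hN).symm).pow_right n
    refine mem_of_coprime_smul _ a m (p ^ n) hc ?_ (by rw [hn]; exact zero_mem _)
    have hx : ∀ x ∈ Submodule.span R (Set.range f),
        m • x ∈ Submodule.span R (Set.range fun i => m • f i) := by
      intro x hx
      induction hx using Submodule.span_induction with
      | mem x hx =>
        obtain ⟨i, rfl⟩ := hx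
        exact Submodule.subset_span ⟨i, rfl⟩
      | zero => simp
      | add x y _ _ hx hy => rw [smul_add]; exact add_mem hx hy
      | smul r x _ hx => rw [smul_comm]; exact Submodule.smul_mem _ r hx
    exact hx a (by rw [hf]; trivial)

theorem kgen_backward {R A : Type*} [Ring R] [AddCommGroup A] [Finite A] [Module R A] (k : ℕ)
    (h : ∀ p : ℕ, p.Prime → p ∣ Nat.card A →
      ∃ f : Fin k → A, Submodule.span R (Set.range f) = primaryPart p) :
    ∃ f : Fin k → A, Submodule.span R (Set.range f) = ⊤ := by
  have hN : Nat.card A ≠ 0 := Nat.card_pos.ne'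
  have h' : ∀ p : ℕ, ∃ f : Fin k → A, p ∈ (Nat.card A).primeFactors →
      Submodule.span R (Set.range f) = primaryPart p := by
    intro p
    by_cases hp : p ∈ (Nat.card A).primeFactors
    · obtain ⟨f, hf⟩ := h p (Nat.prime_of_mem_primeFactors hp) (Nat.dvd_of_mem_primeFactors hp)
      exact ⟨f, fun _ => hf⟩
    · exact ⟨0, fun h => absurd h hp⟩
  choose F hF using h'
  have hker : ∀ p ∈ (Nat.card A).primeFactors, ∀ i, ∃ n : ℕ, p ^ n • F p i = 0 := by
    intro p hp i
    have : F p i ∈ primaryPart (R := R) p := by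
      rw [← hF p hp]; exact Submodule.subset_span ⟨i, rfl⟩
    exact this
  refine ⟨fun i => ∑ p ∈ (Nat.card A).primeFactors, F p i, ?_⟩
  set S := Submodule.span R (Set.range fun i => ∑ p ∈ (Nat.card A).primeFactors, F p i) with hS
  have hle : ∀ p ∈ (Nat.card A).primeFactors, primaryPart p ≤ S := by
    intro p hp
    have hpp := Nat.prime_of_mem_primeFactors hp
    rw [← hF p hp, Submodule.span_le]
    rintro _ ⟨i, rfl⟩
    obtain ⟨n, hn⟩ := hker p hp i
    have hc : Nat.Coprime (ordCompl[p] (Nat.card A)) (p ^ n) :=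
      ((Nat.coprime_ordCompl hpp hN).symm).pow_right n
    refine mem_of_coprime_smul S _ _ _ hc ?_ (by rw [hn]; exact zero_mem _)
    have hsum : ordCompl[p] (Nat.card A) • F p i =
        ordCompl[p] (Nat.card A) • ∑ q ∈ (Nat.card A).primeFactors, F q i := by
      rw [Finset.smul_sum]
      symm
      apply Finset.sum_eq_single_of_mem p hp
      intro q hq hqp
      obtain ⟨t, ht⟩ := hker q hq i
      have hqq := Nat.prime_of_mem_primeFactors hq
      apply addOrderOf_dvd_iff_nsmul_eq_zero.1
      have h1 : addOrderOf (F q i) ∣ q ^ t := addOrderOf_dvd_of_nsmul_eq_zero ht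
      have h2 : addOrderOf (F q i) ∣ ordProj[p] (Nat.card A) * ordCompl[p] (Nat.card A) := by
        rw [Nat.ordProj_mul_ordCompl_eq_self]; exact addOrderOf_dvd_natCard _
      have h3 : Nat.Coprime (q ^ t) (ordProj[p] (Nat.card A)) :=
        Nat.Coprime.pow _ _ ((Nat.coprime_primes hqq hpp).2 hqp)
      exact (Nat.Coprime.coprime_dvd_left h1 h3).dvd_of_dvd_mul_left h2
    rw [hsum]
    exact S.toAddSubgroup.nsmul_mem (Submodule.subset_span ⟨i, rfl⟩) _
  rw [eq_top_iff]
  rintro a -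
  have hdvd : ∀ j : ℕ, j • a ∈ S → addOrderOf (S.mkQ a) ∣ j := by
    intro j hj
    apply addOrderOf_dvd_of_nsmul_eq_zero
    rw [← map_nsmul]
    exact (Submodule.Quotient.mk_eq_zero S).2 hj
  have h1 : addOrderOf (S.mkQ a) = 1 := by
    by_contra hne
    obtain ⟨q, hq, hqd⟩ := Nat.exists_prime_and_dvd hne
    have hqN : q ∣ Nat.card A := hqd.trans (hdvd _ (by
      rw [card_nsmul_eq_zero']; exact zero_mem _))
    have hmem : ordCompl[q] (Nat.card A) • a ∈ S := by
      apply hle q (Nat.mem_primeFactors.2 ⟨hq, hqN, hN⟩)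
      refine ⟨(Nat.card A).factorization q, ?_⟩
      rw [← mul_smul, Nat.ordProj_mul_ordCompl_eq_self]
      exact card_nsmul_eq_zero'
    exact Nat.not_dvd_ordCompl hq hN (hqd.trans (hdvd _ hmem))
  rw [AddMonoid.addOrderOf_eq_one_iff] at h1
  simpa using h1

/-- Žmud'/Gaschütz-style reduction to primary components: a finite module `A` over the
group ring `ℤ[G]` of a finite group `G` is generated by `k` elements if and only if, for
every prime `p` dividing `|A|`, the `p`-primary component of `A` (which is a
`ℤ[G]`-submodule) is generated by `k` elements. -/
theorem finite_zg_module_kgen_iff_primary {G : Type*} [Group G] [Finite G]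
    {A : Type*} [AddCommGroup A] [Finite A] [Module (MonoidAlgebra ℤ G) A] (k : ℕ) :
    (∃ f : Fin k → A, Submodule.span (MonoidAlgebra ℤ G) (Set.range f) = ⊤) ↔
      (∀ p : ℕ, p.Prime → p ∣ Nat.card A →
        ∀ P : Submodule (MonoidAlgebra ℤ G) A,
          (P : Set A) = {a : A | ∃ n : ℕ, p ^ n • a = 0} →
            ∃ f : Fin k → A, Submodule.span (MonoidAlgebra ℤ G) (Set.range f) = P) := by
  constructor
  · rintro ⟨f, hf⟩ p hp _ P hP
    exact kgen_forward k f hf p hp P hP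
  · intro h
    exact kgen_backward k fun p hp hd => h p hp hd (primaryPart p) rfl
end

section
/- Let A be a finite-dimensional algebra over a field K, let V be a finite-dimensional semisimple A-module, and let k ≥ 1. Then V is generated by k elements as an A-module if and only if, for every simple A-module S, dim_K Hom_A(S, V) ≤ k · dim_K S. (Equivalently, in terms of the paper's formulation: the multiplicity of S as a composition factor of V is at most k · dim_D S, where D = End_A(S) is the endomorphism division algebra of S, since Hom_A(S, V) is a free D-module whose rank is that multiplicity.) -/
section Helpers

variable {K : Type} [Field K] {A : Type} [Ring A] [Algebra K A]

theorem hom_finite (M N : Type) [AddCommGroup M] [Module K M] [Module A M] [IsScalarTower K A M]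
    [AddCommGroup N] [Module K N] [Module A N] [IsScalarTower K A N]
    [FiniteDimensional K M] [FiniteDimensional K N] : FiniteDimensional K (M →ₗ[A] N) :=
  FiniteDimensional.of_injective (LinearMap.restrictScalarsₗ K A M N K)
    (LinearMap.restrictScalars_injective K)

/-- `Hom_A(M, -)` carries an `A`-linear equivalence to a `K`-linear one. -/
def homCongrRight (M : Type) {N N' : Type} [AddCommGroup M] [Module A M]
    [AddCommGroup N] [Module K N] [Module A N] [IsScalarTower K A N]
    [AddCommGroup N'] [Module K N'] [Module A N'] [IsScalarTower K A N']
    (e : N ≃ₗ[A] N') : (M →ₗ[A] N) ≃ₗ[K] (M →ₗ[A] N') where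
  toFun f := e.toLinearMap ∘ₗ f
  invFun f := e.symm.toLinearMap ∘ₗ f
  map_add' f g := by ext; simp
  map_smul' c f := by
    ext x
    simp only [LinearMap.comp_apply, LinearMap.smul_apply, RingHom.id_apply]
    exact (e.toLinearMap.restrictScalars K).map_smul c (f x)
  left_inv f := by ext; simp
  right_inv f := by ext; simp

theorem finrank_hom_prod_left (M M' N T : Type)
    [AddCommGroup M] [Module K M] [Module A M] [IsScalarTower K A M] [FiniteDimensional K M]
    [AddCommGroup M'] [Module K M'] [Module A M'] [IsScalarTower K A M'] [FiniteDimensional K M']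
    [AddCommGroup N] [Module A N]
    [AddCommGroup T] [Module K T] [Module A T] [IsScalarTower K A T] [FiniteDimensional K T]
    (e : N ≃ₗ[A] (M × M')) :
    Module.finrank K (N →ₗ[A] T) =
      Module.finrank K (M →ₗ[A] T) + Module.finrank K (M' →ₗ[A] T) := by
  have := hom_finite (K := K) (A := A) M T
  have := hom_finite (K := K) (A := A) M' T
  rw [(LinearEquiv.congrLeft T K e).finrank_eq,
    ← (LinearMap.coprodEquiv (R := A) (M := M) (M₂ := M') (M₃ := T) K).finrank_eq,
    Module.finrank_prod]

theorem finrank_hom_prod_right (M M' N T : Type)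
    [AddCommGroup M] [Module K M] [Module A M] [IsScalarTower K A M] [FiniteDimensional K M]
    [AddCommGroup M'] [Module K M'] [Module A M'] [IsScalarTower K A M'] [FiniteDimensional K M']
    [AddCommGroup N] [Module K N] [Module A N] [IsScalarTower K A N]
    [AddCommGroup T] [Module K T] [Module A T] [IsScalarTower K A T] [FiniteDimensional K T]
    (e : N ≃ₗ[A] (M × M')) :
    Module.finrank K (T →ₗ[A] N) =
      Module.finrank K (T →ₗ[A] M) + Module.finrank K (T →ₗ[A] M') := by
  have := hom_finite (K := K) (A := A) T M
  have := hom_finite (K := K) (A := A) T M'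
  rw [(homCongrRight (K := K) T e).finrank_eq,
    ← (LinearMap.prodEquiv (R := A) (M := T) (M₂ := M) (M₃ := M') K).finrank_eq,
    Module.finrank_prod]

theorem finrank_hom_simple (S T : Type)
    [AddCommGroup S] [Module K S] [Module A S] [IsScalarTower K A S]
    [AddCommGroup T] [Module K T] [Module A T] [IsScalarTower K A T]
    [IsSimpleModule A S] [IsSimpleModule A T] :
    Module.finrank K (S →ₗ[A] T) = Module.finrank K (T →ₗ[A] S) := by
  by_cases h : Nonempty (S ≃ₗ[A] T)
  · obtain ⟨e⟩ := h
    rw [(homCongrRight (K := K) T e).finrank_eq, (LinearEquiv.congrLeft T K e).finrank_eq]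
  · have h1 : Subsingleton (S →ₗ[A] T) := by
      refine subsingleton_of_forall_eq 0 fun f => ?_
      exact f.bijective_or_eq_zero.resolve_left fun hf => h ⟨LinearEquiv.ofBijective f hf⟩
    have h2 : Subsingleton (T →ₗ[A] S) := by
      refine subsingleton_of_forall_eq 0 fun f => ?_
      exact f.bijective_or_eq_zero.resolve_left fun hf => h ⟨(LinearEquiv.ofBijective f hf).symm⟩
    rw [Module.finrank_zero_of_subsingleton, Module.finrank_zero_of_subsingleton]

/-- Splitting off a simple summand. -/
theorem exists_split (V : Type) [AddCommGroup V] [Module K V] [Module A V] [IsScalarTower K A V]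
    [FiniteDimensional K V] [IsSemisimpleModule A V] [Nontrivial V] :
    ∃ S V' : Submodule A V, IsSimpleModule A S ∧ Nonempty (V ≃ₗ[A] (S × V')) ∧
      Module.finrank K V' < Module.finrank K V := by
  obtain ⟨S, hS⟩ := IsSemisimpleModule.exists_simple_submodule A V
  obtain ⟨V', hc⟩ := exists_isCompl S
  refine ⟨S, V', hS, ⟨(Submodule.prodEquivOfIsCompl S V' hc).symm⟩, ?_⟩
  have := ((Submodule.prodEquivOfIsCompl S V' hc).restrictScalars K).finrank_eq
  have hSf : FiniteDimensional K S := inferInstanceAs (FiniteDimensional K (S.restrictScalars K))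
  have hVf : FiniteDimensional K V' := inferInstanceAs (FiniteDimensional K (V'.restrictScalars K))
  rw [Module.finrank_prod] at this
  have hn : Nontrivial S := IsSimpleModule.nontrivial A S
  have : 0 < Module.finrank K S := Module.finrank_pos
  omega

theorem finrank_hom_symm (T : Type)
    [AddCommGroup T] [Module K T] [Module A T] [IsScalarTower K A T] [FiniteDimensional K T]
    [IsSimpleModule A T] (n : ℕ) :
    ∀ (V : Type) [AddCommGroup V] [Module K V] [Module A V] [IsScalarTower K A V]
      [FiniteDimensional K V] [IsSemisimpleModule A V], Module.finrank K V = n →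
      Module.finrank K (V →ₗ[A] T) = Module.finrank K (T →ₗ[A] V) := by
  induction n using Nat.strong_induction_on with
  | _ n ih =>
    intro V _ _ _ _ _ _ hn
    rcases subsingleton_or_nontrivial V with h | h
    · have h2 : Subsingleton (T →ₗ[A] V) := ⟨fun f g => by ext; exact Subsingleton.elim _ _⟩
      have h1 : Subsingleton (V →ₗ[A] T) := ⟨fun f g => by
        ext x; rw [Subsingleton.elim x 0, map_zero, map_zero]⟩
      rw [Module.finrank_zero_of_subsingleton, Module.finrank_zero_of_subsingleton]
    · obtain ⟨S, V', hS, ⟨e⟩, hlt⟩ := exists_split (K := K) (A := A) V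
      have hSf : FiniteDimensional K S :=
        inferInstanceAs (FiniteDimensional K (S.restrictScalars K))
      have hVf : FiniteDimensional K V' :=
        inferInstanceAs (FiniteDimensional K (V'.restrictScalars K))
      rw [finrank_hom_prod_left S V' V T e, finrank_hom_prod_right S V' V T e,
        finrank_hom_simple (K := K) (A := A) S T, ih _ (hn ▸ hlt) V' rfl]

theorem exists_surj (n : ℕ) :
    ∀ (V W : Type) [AddCommGroup V] [Module K V] [Module A V] [IsScalarTower K A V]
      [FiniteDimensional K V] [IsSemisimpleModule A V]
      [AddCommGroup W] [Module K W] [Module A W] [IsScalarTower K A W]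
      [FiniteDimensional K W] [IsSemisimpleModule A W], Module.finrank K V = n →
      (∀ (T : Type) [AddCommGroup T] [Module K T] [Module A T] [IsScalarTower K A T]
        [FiniteDimensional K T] [IsSimpleModule A T],
        Module.finrank K (V →ₗ[A] T) ≤ Module.finrank K (W →ₗ[A] T)) →
      ∃ p : W →ₗ[A] V, Function.Surjective p := by
  induction n using Nat.strong_induction_on with
  | _ n ih =>
    intro V W _ _ _ _ _ _ _ _ _ _ _ _ hn hle
    rcases subsingleton_or_nontrivial V with h | h
    · exact ⟨0, fun v => ⟨0, Subsingleton.elim _ _⟩⟩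
    · obtain ⟨S, V', hS, ⟨e⟩, hlt⟩ := exists_split (K := K) (A := A) V
      have hSf : FiniteDimensional K S :=
        inferInstanceAs (FiniteDimensional K (S.restrictScalars K))
      have hVf : FiniteDimensional K V' :=
        inferInstanceAs (FiniteDimensional K (V'.restrictScalars K))
      have hpos : 0 < Module.finrank K (W →ₗ[A] S) := by
        refine lt_of_lt_of_le ?_ (hle S)
        rw [finrank_hom_prod_left S V' V S e]
        have := hom_finite (K := K) (A := A) S S
        have hn : Nontrivial S := IsSimpleModule.nontrivial A S
        have : Nontrivial (S →ₗ[A] S) := inferInstanceAs (Nontrivial (Module.End A S))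
        have : 0 < Module.finrank K (S →ₗ[A] S) := Module.finrank_pos
        omega
      have hnt : Nontrivial (W →ₗ[A] S) := by
        by_contra hc
        rw [not_nontrivial_iff_subsingleton] at hc
        rw [Module.finrank_zero_of_subsingleton] at hpos
        omega
      obtain ⟨g, hg⟩ := exists_ne (0 : W →ₗ[A] S)
      have hgs := g.surjective_or_eq_zero.resolve_right hg
      obtain ⟨Q, hQ⟩ := exists_isCompl (LinearMap.ker g)
      have eQ : Q ≃ₗ[A] S := (Submodule.quotientEquivOfIsCompl _ Q hQ).symm ≪≫ₗ
        g.quotKerEquivOfSurjective hgs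
      have eW : W ≃ₗ[A] (S × LinearMap.ker g) :=
        (Submodule.prodEquivOfIsCompl _ _ hQ.symm).symm ≪≫ₗ
          LinearEquiv.prodCongr eQ (LinearEquiv.refl A _)
      have hkf : FiniteDimensional K (LinearMap.ker g) :=
        inferInstanceAs (FiniteDimensional K ((LinearMap.ker g).restrictScalars K))
      obtain ⟨p, hp⟩ := ih _ (hn ▸ hlt) V' (LinearMap.ker g) rfl (by
        intro T _ _ _ _ _ _
        have := hle T
        rw [finrank_hom_prod_left S V' V T e,
          finrank_hom_prod_left S (LinearMap.ker g) W T eW] at this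
        omega)
      refine ⟨e.symm.toLinearMap ∘ₗ (LinearMap.prodMap LinearMap.id p) ∘ₗ eW.toLinearMap, ?_⟩
      intro v
      obtain ⟨w, hw⟩ := hp (e v).2
      refine ⟨eW.symm ((e v).1, w), ?_⟩
      simp [hw]

/-- Elements of a simple module `T` give maps from `A` modulo its radical. -/
theorem finrank_le_hom_quot [FiniteDimensional K A] (T : Type)
    [AddCommGroup T] [Module K T] [Module A T] [IsScalarTower K A T] [FiniteDimensional K T]
    [IsSimpleModule A T] :
    Module.finrank K T ≤ Module.finrank K ((A ⧸ Module.jacobson A A) →ₗ[A] T) := by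
  have hqf : FiniteDimensional K (A ⧸ Module.jacobson A A) :=
    inferInstanceAs (FiniteDimensional K (A ⧸ (Module.jacobson A A).restrictScalars K))
  have := hom_finite (K := K) (A := A) (A ⧸ Module.jacobson A A) T
  let φ : T →ₗ[K] ((A ⧸ Module.jacobson A A) →ₗ[A] T) :=
    { toFun := fun t => Submodule.liftQ _ (LinearMap.toSpanSingleton A T t)
        (IsSemisimpleModule.jacobson_le_ker A A A T _)
      map_add' := fun x y => by
        refine LinearMap.ext fun q => ?_
        obtain ⟨a, rfl⟩ := Submodule.Quotient.mk_surjective _ q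
        exact smul_add a x y
      map_smul' := fun c x => by
        refine LinearMap.ext fun q => ?_
        obtain ⟨a, rfl⟩ := Submodule.Quotient.mk_surjective _ q
        exact smul_comm a c x }
  refine LinearMap.finrank_le_finrank_of_injective (f := φ) ?_
  intro x y h
  have h1 : (1 : A) • x = (1 : A) • y := LinearMap.congr_fun h (Submodule.Quotient.mk 1)
  simpa using h1

end Helpers

/-- Let `A` be a finite-dimensional algebra over a field `K` and `V` a finite-dimensional
semisimple `A`-module.  Then `V` is generated by `k` elements as an `A`-module if and
only if for every simple `A`-module `S` one has
`dim_K Hom_A(S, V) ≤ k · dim_K S`. -/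
theorem semisimple_kgen_iff_multiplicity {K : Type} [Field K]
    {A : Type} [Ring A] [Algebra K A] [FiniteDimensional K A]
    {V : Type} [AddCommGroup V] [Module K V] [Module A V] [IsScalarTower K A V]
    [FiniteDimensional K V] (hV : IsSemisimpleModule A V) (k : ℕ) (hk : 1 ≤ k) :
    (∃ f : Fin k → V, Submodule.span A (Set.range f) = ⊤) ↔
      (∀ (S : Type) (_ : AddCommGroup S) (_ : Module K S) (_ : Module A S)
        (_ : IsScalarTower K A S), IsSimpleModule A S →
          Module.finrank K (S →ₗ[A] V) ≤ k * Module.finrank K S) := by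
  have simple_fin : ∀ (S : Type) [AddCommGroup S] [Module K S] [Module A S]
      [IsScalarTower K A S] [IsSimpleModule A S], FiniteDimensional K S := by
    intro S _ _ _ _ _
    exact Module.Finite.trans A S
  constructor
  · rintro ⟨f, hf⟩ S _ _ _ _ hS
    have hSf := simple_fin S
    rw [← finrank_hom_symm (K := K) (A := A) S _ V rfl]
    let ψ : (V →ₗ[A] S) →ₗ[K] (Fin k → S) :=
      { toFun := fun g i => g (f i)
        map_add' := fun _ _ => rfl
        map_smul' := fun _ _ => rfl }
    have hψ : Function.Injective ψ := by
      intro g h hgh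
      apply LinearMap.ext_on hf
      rintro _ ⟨i, rfl⟩
      exact congrFun hgh i
    have := LinearMap.finrank_le_finrank_of_injective hψ
    simpa [Module.finrank_pi_fintype] using this
  · intro H
    have hA : IsArtinianRing A := IsArtinianRing.of_finite K A
    have hqf : FiniteDimensional K (A ⧸ Module.jacobson A A) :=
      inferInstanceAs (FiniteDimensional K (A ⧸ (Module.jacobson A A).restrictScalars K))
    have hqs : IsSemisimpleModule A (A ⧸ Module.jacobson A A) :=
      (IsArtinian.isSemisimpleModule_iff_jacobson A _).2 (Module.jacobson_quotient_jacobson A A)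
    obtain ⟨p, hp⟩ := exists_surj (K := K) (A := A) _ V (Fin k → A ⧸ Module.jacobson A A) rfl (by
      intro T _ _ _ _ _ _
      rw [finrank_hom_symm (K := K) (A := A) T _ V rfl]
      refine (H T inferInstance inferInstance inferInstance inferInstance inferInstance).trans ?_
      have := hom_finite (K := K) (A := A) (A ⧸ Module.jacobson A A) T
      rw [← (LinearMap.lsum A (fun _ : Fin k => A ⧸ Module.jacobson A A) (M := T) K).finrank_eq,
        Module.finrank_pi_fintype]
      simpa using Nat.mul_le_mul_left k (finrank_le_hom_quot (K := K) (A := A) T))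
    refine ⟨fun i => p (Pi.single i (Submodule.Quotient.mk 1)), ?_⟩
    rw [← Fintype.range_linearCombination, LinearMap.range_eq_top]
    intro v
    obtain ⟨w, rfl⟩ := hp v
    choose a ha using fun i => Submodule.Quotient.mk_surjective _ (w i)
    refine ⟨a, ?_⟩
    rw [Fintype.linearCombination_apply]
    simp_rw [← map_smul]
    rw [← map_sum]
    congr 1
    ext j
    rw [Finset.sum_apply, Finset.sum_eq_single j]
    · rw [Pi.smul_apply, Pi.single_eq_same, ← ha j, ← Submodule.Quotient.mk_smul]
      simp
    · intro b _ hb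
      simp [Pi.single_eq_of_ne hb.symm]
    · simp
end

section
/- Let K be a field, G a finite group, and V a finite-dimensional semisimple K[G]-module. Then for any k ≥ 1, V is generated by k elements as a K[G]-module if and only if its contragredient V* is generated by k elements as a K[G]-module. -/
/-- A finite-dimensional semisimple algebra has a functional whose kernel contains no nonzero
left ideal. -/
theorem exists_nondegenerate_functional (K B : Type*) [Field K] [Ring B] [Algebra K B]
    [FiniteDimensional K B] [IsSemisimpleRing B] :
    ∃ l : B →ₗ[K] K, ∀ b : B, (∀ x : B, l (x * b) = 0) → b = 0 := by
  classical
  obtain ⟨n, D, d, _, _, _, _, ⟨e⟩⟩ :=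
    IsSemisimpleRing.exists_algEquiv_pi_matrix_divisionRing_finite K B
  have hl : ∀ i, ∃ l : D i →ₗ[K] K, l 1 = 1 := fun i =>
    Module.Projective.exists_dual_eq_one K (one_ne_zero)
  choose l hl using hl
  let L : (Π i, Matrix (Fin (d i)) (Fin (d i)) (D i)) →ₗ[K] K :=
    ∑ i, (l i) ∘ₗ (Matrix.traceLinearMap (Fin (d i)) K (D i)) ∘ₗ LinearMap.proj i
  refine ⟨L ∘ₗ e.toLinearMap, fun b hb => ?_⟩
  have hb' : ∀ y, L (y * e b) = 0 := fun y => by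
    have := hb (e.symm y)
    simpa using this
  apply e.injective
  rw [map_zero]
  funext i
  ext p q
  by_contra hne
  change e b i p q ≠ 0 at hne
  have h := hb' (Pi.single i (Matrix.single q p (e b i p q)⁻¹))
  have h2 : L (Pi.single i (Matrix.single q p (e b i p q)⁻¹) * e b)
      = l i ((Matrix.single q p (e b i p q)⁻¹ * e b i).trace) := by
    simp only [L, LinearMap.sum_apply, LinearMap.comp_apply, LinearMap.proj_apply,
      Matrix.traceLinearMap_apply]
    rw [Finset.sum_eq_single i]
    · simp
    · intro j _ hj
      simp [Pi.single_eq_of_ne hj]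
    · simp
  rw [h2, Matrix.trace_single_mul, smul_eq_mul, inv_mul_cancel₀ hne, hl] at h
  exact one_ne_zero h

theorem kgen_semisimple_aux (K B V : Type*) [Field K] [Ring B] [Algebra K B]
    [FiniteDimensional K B] [IsSemisimpleRing B] [AddCommGroup V] [Module K V] [Module B V]
    [IsScalarTower K B V] (k : ℕ) :
    (∃ v : Fin k → V, ∀ w, ∃ b : Fin k → B, ∑ i, b i • v i = w) ↔
    (∃ f : Fin k → (V →ₗ[K] K), ∀ w, (∀ i, ∀ b : B, f i (b • w) = 0) → w = 0) := by
  classical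
  obtain ⟨l, hl⟩ := exists_nondegenerate_functional K B
  constructor
  · rintro ⟨v, hv⟩
    let π : (Fin k → B) →ₗ[B] V := Fintype.linearCombination B v
    have hπ : LinearMap.range π = ⊤ := by
      rw [LinearMap.range_eq_top]
      intro w
      obtain ⟨b, hb⟩ := hv w
      exact ⟨b, by simpa [π, Fintype.linearCombination_apply] using hb⟩
    obtain ⟨s, hs⟩ := IsSemisimpleModule.lifting_property π (LinearMap.range_eq_top.1 hπ) LinearMap.id
    refine ⟨fun i => l ∘ₗ (LinearMap.proj i) ∘ₗ (s.restrictScalars K), fun w hw => ?_⟩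
    have : s w = 0 := by
      funext i
      apply hl
      intro x
      simpa using hw i x
    have h2 := LinearMap.congr_fun hs w
    simpa [this] using h2.symm
  · rintro ⟨f, hf⟩
    let T : B →ₗ[K] (B →ₗ[K] K) := (LinearMap.mul K B).flip.compr₂ l
    have hT : ∀ b x, T b x = l (x * b) := fun b x => by simp [T]
    have hTi : Function.Injective T := by
      rw [injective_iff_map_eq_zero]
      intro b hb
      exact hl b fun x => by rw [← hT, hb]; rfl
    have hTs : Function.Surjective T :=
      (LinearMap.injective_iff_surjective_of_finrank_eq_finrank
        (Subspace.dual_finrank_eq (K := K) (V := B)).symm).1 hTi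
    have hc : ∀ i w, ∃ c : B, ∀ x, l (x * c) = f i (x • w) := fun i w => by
      obtain ⟨c, hc⟩ := hTs (f i ∘ₗ ((LinearMap.toSpanSingleton B V w).restrictScalars K))
      exact ⟨c, fun x => by rw [← hT, hc]; simp⟩
    choose c hc using hc
    have huniq : ∀ a b : B, (∀ x, l (x * a) = l (x * b)) → a = b := fun a b h => by
      rw [← sub_eq_zero]
      exact hl _ fun x => by rw [mul_sub, map_sub, h, sub_self]
    let φ : V →ₗ[B] (Fin k → B) :=
      { toFun := fun w i => c i w
        map_add' := fun w w' => by
          funext i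
          apply huniq
          intro x
          simp [hc, mul_add]
        map_smul' := fun a w => by
          funext i
          apply huniq
          intro x
          simp [hc, ← mul_assoc, mul_smul] }
    have hφ : Function.Injective φ := by
      rw [injective_iff_map_eq_zero]
      intro w hw
      refine hf w fun i b => ?_
      rw [← hc]
      have : c i w = 0 := congrFun hw i
      rw [this]
      simp
    obtain ⟨p, hp⟩ := IsSemisimpleModule.extension_property φ hφ LinearMap.id
    refine ⟨fun i => p (Pi.single i 1), fun w => ⟨φ w, ?_⟩⟩
    have h1 := LinearMap.congr_fun hp w
    simp only [LinearMap.comp_apply, LinearMap.id_apply] at h1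
    conv_rhs => rw [← h1, pi_eq_sum_univ' (φ w), map_sum]
    refine Finset.sum_congr rfl fun i _ => ?_
    rw [← map_smul]

theorem kgen_algebra_aux (K A V : Type*) [Field K] [Ring A] [Algebra K A]
    [FiniteDimensional K A] [AddCommGroup V] [Module K V] [Module A V]
    [IsScalarTower K A V] [IsSemisimpleModule A V] (k : ℕ) :
    (∃ v : Fin k → V, ∀ w, ∃ b : Fin k → A, ∑ i, b i • v i = w) ↔
    (∃ f : Fin k → (V →ₗ[K] K), ∀ w, (∀ i, ∀ b : A, f i (b • w) = 0) → w = 0) := by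
  have : IsArtinianRing A := IsArtinianRing.of_finite K A
  have hM : Module.IsTorsionBySet A V (Ring.jacobson A : Set A) := by
    intro w a
    exact Module.mem_annihilator.1
      (IsSemisimpleModule.jacobson_le_annihilator A V a.2) w
  let := hM.module
  have hsm : ∀ (a : A) (w : V), (Ideal.Quotient.mk (Ring.jacobson A) a) • w = a • w :=
    fun a w => rfl
  have : IsScalarTower K (A ⧸ Ring.jacobson A) V := hM.isScalarTower
  have : FiniteDimensional K (A ⧸ Ring.jacobson A) :=
    Module.Finite.of_surjective (Ideal.Quotient.mkₐ K (Ring.jacobson A)).toLinearMap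
      Ideal.Quotient.mk_surjective
  have key := kgen_semisimple_aux K (A ⧸ Ring.jacobson A) V k
  have e1 : ∀ v : Fin k → V, ∀ w, (∃ b : Fin k → A, ∑ i, b i • v i = w) ↔
      ∃ b : Fin k → A ⧸ Ring.jacobson A, ∑ i, b i • v i = w := by
    intro v w
    constructor
    · rintro ⟨b, hb⟩
      exact ⟨fun i => Ideal.Quotient.mk _ (b i), by simpa only [hsm] using hb⟩
    · rintro ⟨b, hb⟩
      choose a ha using fun i => Ideal.Quotient.mk_surjective (b i)
      exact ⟨a, by simpa only [← ha, hsm] using hb⟩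
  have e2 : ∀ (g : V →ₗ[K] K) (w : V), (∀ b : A, g (b • w) = 0) ↔
      ∀ b : A ⧸ Ring.jacobson A, g (b • w) = 0 := by
    intro g w
    rw [Ideal.Quotient.mk_surjective.forall]
    simp only [hsm]
  simp only [e1, e2]
  exact key

theorem dual_gen_aux {K G V : Type*} [Field K] [Group G]
    [AddCommGroup V] [Module K V] [FiniteDimensional K V]
    (ρ : Representation K G V) (k : ℕ) (f : Fin k → Module.Dual K V) :
    Submodule.span (MonoidAlgebra K G) (Set.range fun i => ρ.dual.asModuleEquiv.symm (f i)) = ⊤ ↔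
    ∀ w : ρ.asModule, (∀ i, ∀ b : MonoidAlgebra K G, f i (ρ.asModuleEquiv (b • w)) = 0) →
      w = 0 := by
  set S := Submodule.span (MonoidAlgebra K G)
    (Set.range fun i => ρ.dual.asModuleEquiv.symm (f i)) with hS
  let W : Submodule K (Module.Dual K V) :=
    (S.restrictScalars K).map ρ.dual.asModuleEquiv.toLinearMap
  have hWmem : ∀ x : ρ.dual.asModule, ρ.dual.asModuleEquiv x ∈ W ↔ x ∈ S := by
    intro x
    simp [W]
  have hW : S = ⊤ ↔ W = ⊤ := by
    simp only [Submodule.eq_top_iff']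
    constructor
    · intro h x
      have := (hWmem (ρ.dual.asModuleEquiv.symm x)).2 (h _)
      simpa using this
    · intro h x
      exact (hWmem x).1 (h _)
  have hW2 : W = ⊤ ↔ W.dualCoannihilator = ⊥ := by
    constructor
    · rintro h
      rw [h, Submodule.dualCoannihilator_top]
    · intro h
      rw [← Subspace.dualCoannihilator_dualAnnihilator_eq (W := W), h,
        Submodule.dualAnnihilator_bot]
  have hco : ∀ w : ρ.asModule, ρ.asModuleEquiv w ∈ W.dualCoannihilator ↔
      ∀ i, ∀ b : MonoidAlgebra K G, f i (ρ.asModuleEquiv (b • w)) = 0 := by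
    intro w
    rw [Submodule.mem_dualCoannihilator]
    constructor
    · intro h i b
      induction b using MonoidAlgebra.induction_linear with
      | zero => simp
      | add a b ha hb => rw [add_smul, map_add, map_add, ha, hb, add_zero]
      | single g r =>
        have hm : MonoidAlgebra.single g⁻¹ r • ρ.dual.asModuleEquiv.symm (f i) ∈ S :=
          S.smul_mem _ (Submodule.subset_span ⟨i, rfl⟩)
        have := h _ ((hWmem _).2 hm)
        rw [Representation.asModuleEquiv_map_smul] at this ⊢
        simpa [Module.Dual.transpose_apply] using this
    · intro h φ hφ
      obtain ⟨x, rfl⟩ := ρ.dual.asModuleEquiv.surjective φ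
      rw [hWmem] at hφ
      have hx : ∀ b : MonoidAlgebra K G,
          (ρ.dual.asModuleEquiv x) (ρ.asModuleEquiv (b • w)) = 0 := by
        induction hφ using Submodule.span_induction with
        | mem x hx =>
          obtain ⟨i, rfl⟩ := hx
          intro b
          simpa using h i b
        | zero => simp
        | add x y _ _ hx hy =>
          intro b
          rw [map_add, LinearMap.add_apply, hx, hy, add_zero]
        | smul a x _ hx =>
          induction a using MonoidAlgebra.induction_linear with
          | zero => simp
          | add a a' ha ha' =>
            intro b
            rw [add_smul, map_add, LinearMap.add_apply, ha, ha', add_zero]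
          | single g r =>
            intro b
            have := hx (MonoidAlgebra.single g⁻¹ r * b)
            rw [mul_smul, Representation.asModuleEquiv_map_smul] at this
            rw [Representation.asModuleEquiv_map_smul]
            simpa [Module.Dual.transpose_apply] using this
      simpa using hx 1
  rw [hW, hW2, Submodule.eq_bot_iff]
  constructor
  · intro h w hw
    have := h _ ((hco w).2 hw)
    simpa using this
  · intro h x hx
    have := h (ρ.asModuleEquiv.symm x) ((hco _).1 (by simpa using hx))
    simpa using this

/-- A finite-dimensional semisimple module `V` over the group algebra `K[G]` of a finite
group `G` (presented via a representation) is generated by `k` elements if and only if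
its contragredient (dual) module `V*` is generated by `k` elements. -/
theorem kgen_iff_dual_kgen {K G V : Type*} [Field K] [Group G] [Finite G]
    [AddCommGroup V] [Module K V] [FiniteDimensional K V]
    (ρ : Representation K G V)
    (hss : IsSemisimpleModule (MonoidAlgebra K G) ρ.asModule) (k : ℕ) (hk : 1 ≤ k) :
    (∃ f : Fin k → ρ.asModule,
        Submodule.span (MonoidAlgebra K G) (Set.range f) = ⊤) ↔
      (∃ f : Fin k → ρ.dual.asModule,
        Submodule.span (MonoidAlgebra K G) (Set.range f) = ⊤) := by
  have : FiniteDimensional K (MonoidAlgebra K G) :=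
    Module.Finite.of_basis (MonoidAlgebra.basis G K)
  have key := kgen_algebra_aux K (MonoidAlgebra K G) ρ.asModule k
  have e1 : ∀ f : Fin k → ρ.asModule,
      Submodule.span (MonoidAlgebra K G) (Set.range f) = ⊤ ↔
      ∀ w, ∃ b : Fin k → MonoidAlgebra K G, ∑ i, b i • f i = w := by
    intro f
    rw [Submodule.eq_top_iff']
    simp only [Submodule.mem_span_range_iff_exists_fun]
  simp only [e1]
  rw [key]
  constructor
  · rintro ⟨f, hf⟩
    refine ⟨_, (dual_gen_aux ρ k
      (fun i => f i ∘ₗ ρ.asModuleEquiv.symm.toLinearMap)).2 fun w hw => hf w fun i b => ?_⟩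
    exact hw i b
  · rintro ⟨f, hf⟩
    refine ⟨fun i => ρ.dual.asModuleEquiv (f i) ∘ₗ ρ.asModuleEquiv.toLinearMap, ?_⟩
    have := (dual_gen_aux ρ k (fun i => ρ.dual.asModuleEquiv (f i))).1 (by simpa using hf)
    exact fun w hw => this w fun i b => by simpa using hw i b
end

section
/- Let G be a finite group, N a normal subgroup of G, and F a field of characteristic p ≥ 0. The following are equivalent: (1) there exists a finite-dimensional semisimple F[G]-module V whose associated representation restricts to a faithful representation of N (i.e., the only element of N acting as the identity on V is 1); (2) p does not divide |A(G) ∩ N|; (3) p = 0 or N has no nontrivial normal p-subgroup. -/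
/-- A minimal normal subgroup of a group `G`: a nontrivial normal subgroup that is
minimal among the nontrivial normal subgroups of `G`. -/
def IsMinimalNormal {G : Type*} [Group G] (M : Subgroup G) : Prop :=
  M.Normal ∧ M ≠ ⊥ ∧ ∀ K : Subgroup G, K.Normal → K ≠ ⊥ → K ≤ M → K = M

/-- `A(G)`: the subgroup generated by all abelian minimal normal subgroups of `G`. -/
def aSocle (G : Type*) [Group G] : Subgroup G :=
  sSup {M : Subgroup G | IsMinimalNormal M ∧ ∀ x ∈ M, ∀ y ∈ M, x * y = y * x}

theorem aSocle_comm {G : Type*} [Group G] : aSocle G ≤ Subgroup.centralizer (aSocle G : Set G) := by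
  have key : ∀ M M' : Subgroup G, (IsMinimalNormal M ∧ ∀ x ∈ M, ∀ y ∈ M, x * y = y * x) →
      (IsMinimalNormal M' ∧ ∀ x ∈ M', ∀ y ∈ M', x * y = y * x) →
      M ≤ Subgroup.centralizer (M' : Set G) := by
    rintro M M' ⟨hM, hc⟩ ⟨hM', hc'⟩ x hx
    rw [Subgroup.mem_centralizer_iff]
    intro y hy
    by_cases h : M ⊓ M' = ⊥
    · exact (Subgroup.commute_of_normal_of_disjoint M M' hM.1 hM'.1 (disjoint_iff.mpr h)
        x y hx hy).symm
    · have := hM.1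
      have := hM'.1
      have h1 := hM.2.2 (M ⊓ M') inferInstance h inf_le_left
      have h2 := hM'.2.2 (M ⊓ M') inferInstance h inf_le_right
      have h3 : M = M' := h1.symm.trans h2
      subst h3
      exact hc y hy x hx
  refine sSup_le fun M hM => ?_
  rw [Subgroup.le_centralizer_iff]
  exact sSup_le fun M' hM' => key M' M hM' hM

theorem aSocle_normal {G : Type*} [Group G] : (aSocle G).Normal := by
  refine ⟨fun x hx g => ?_⟩
  have : aSocle G ≤ (aSocle G).comap (MulAut.conj g).toMonoidHom := by
    refine sSup_le fun M hM x hx => ?_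
    rw [Subgroup.mem_comap]
    exact (le_sSup hM : M ≤ aSocle G) (hM.1.1.conj_mem x hx g)
  exact this hx

/-- If `p` divides `|A(G) ∩ N|` then `N` has a nontrivial normal `p`-subgroup. -/
theorem exists_normal_of_dvd {G : Type*} [Group G] [Finite G] (N : Subgroup G) (p : ℕ)
    [hp : Fact p.Prime] (h : p ∣ Nat.card ↥(aSocle G ⊓ N)) :
    ∃ P : Subgroup ↥N, P.Normal ∧ IsPGroup p ↥P ∧ P ≠ ⊥ := by
  have hcomm : ∀ x ∈ aSocle G, ∀ y ∈ aSocle G, Commute x y := fun x hx y hy =>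
    (Subgroup.mem_centralizer_iff.mp (aSocle_comm hx) y hy).symm
  let P : Subgroup ↥N :=
    { carrier := {x | (x : G) ∈ aSocle G ∧ ∃ k : ℕ, x ^ p ^ k = 1}
      one_mem' := ⟨(aSocle G).one_mem, 0, by simp⟩
      mul_mem' := by
        rintro a b ⟨ha, k, hk⟩ ⟨hb, l, hl⟩
        refine ⟨(aSocle G).mul_mem ha hb, k + l, ?_⟩
        have hab : Commute a b := Subtype.ext (hcomm _ ha _ hb)
        rw [hab.mul_pow, pow_add, pow_mul, hk, one_pow, mul_comm (p ^ k), pow_mul, hl, one_pow,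
          one_mul]
      inv_mem' := by
        rintro a ⟨ha, k, hk⟩
        exact ⟨(aSocle G).inv_mem ha, k, by rw [inv_pow, hk, inv_one]⟩ }
  refine ⟨P, ⟨?_⟩, ?_, ?_⟩
  · rintro a ⟨ha, k, hk⟩ g
    exact ⟨aSocle_normal.conj_mem _ ha g, k, by rw [conj_pow, hk]; simp⟩
  · rintro ⟨x, hx, k, hk⟩
    exact ⟨k, Subtype.ext hk⟩
  · intro hP
    obtain ⟨x, hx⟩ := exists_prime_orderOf_dvd_card' p h
    have hx1 : x ^ p = 1 := hx ▸ pow_orderOf_eq_one x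
    have hm : (⟨x.1, x.2.2⟩ : N) ∈ P := ⟨x.2.1, 1, Subtype.ext (by
      have := congrArg Subtype.val hx1
      simpa using this)⟩
    rw [hP, Subgroup.mem_bot] at hm
    have hm' : (x : G) = 1 := congrArg (fun z : N => (z : G)) hm
    have : x = 1 := Subtype.ext hm'
    rw [this, orderOf_one] at hx
    exact hp.out.ne_one hx.symm

/-- From a nontrivial normal `p`-subgroup of `N ⊲ G` get an abelian minimal normal `p`-subgroup
of `G` contained in `N`. -/
theorem exists_minimal_of_normal {G : Type*} [Group G] [Finite G] (N : Subgroup G)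
    (hN : N.Normal) (p : ℕ) [hp : Fact p.Prime] (P : Subgroup ↥N) (hP : P.Normal)
    (hPp : IsPGroup p ↥P) (hne : P ≠ ⊥) :
    ∃ M : Subgroup G, IsMinimalNormal M ∧ (∀ x ∈ M, ∀ y ∈ M, x * y = y * x) ∧ M ≤ N ∧
      IsPGroup p ↥M := by
  let Q : Subgroup ↥N := sSup {H | H.Normal ∧ IsPGroup p ↥H}
  have hQp : IsPGroup p ↥Q := Sylow.sSup_of_normal _ (fun H h => h.2) (fun H h => h.1)
  have hPQ : P ≤ Q := le_sSup ⟨hP, hPp⟩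
  have hQc : Q.Characteristic := by
    rw [Subgroup.characteristic_iff_le_comap]
    intro φ
    refine sSup_le fun H hH => ?_
    rw [← Subgroup.map_le_iff_le_comap]
    exact le_sSup ⟨hH.1.map _ φ.surjective, hH.2.map _⟩
  let Q' : Subgroup G := Q.map N.subtype
  have hQ'n : Q'.Normal := inferInstance
  have hQ'p : IsPGroup p ↥Q' := hQp.map _
  have hQ'ne : Q' ≠ ⊥ := by
    intro h
    rw [Subgroup.map_eq_bot_iff_of_injective _ N.subtype_injective] at h
    exact hne (le_bot_iff.mp (h ▸ hPQ))
  obtain ⟨M, hMm⟩ := Set.Finite.exists_minimal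
    (Set.toFinite {K : Subgroup G | K.Normal ∧ K ≠ ⊥ ∧ K ≤ Q'}) ⟨Q', hQ'n, hQ'ne, le_rfl⟩
  have hM : M.Normal ∧ M ≠ ⊥ ∧ M ≤ Q' := hMm.prop
  have hmin : ∀ K : Subgroup G, (K.Normal ∧ K ≠ ⊥ ∧ K ≤ Q') → K ≤ M → K = M :=
    fun K hK hKM => hKM.antisymm (hMm.le_of_le hK hKM)
  have hMn := hM.1
  have hMin : IsMinimalNormal M :=
    ⟨hM.1, hM.2.1, fun K h1 h2 h3 => hmin K ⟨h1, h2, h3.trans hM.2.2⟩ h3⟩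
  have hMp : IsPGroup p ↥M := hQ'p.to_le hM.2.2
  refine ⟨M, hMin, ?_, hM.2.2.trans (Subgroup.map_subtype_le _), hMp⟩
  have : Nontrivial ↥M := (Subgroup.nontrivial_iff_ne_bot M).mpr hM.2.1
  have hc := hMp.bot_lt_center
  have hZ : (Subgroup.center ↥M).map M.subtype = M := by
    refine hMin.2.2 _ inferInstance ?_ (Subgroup.map_subtype_le _)
    rw [Ne, Subgroup.map_eq_bot_iff_of_injective _ M.subtype_injective]
    exact hc.ne'
  intro x hx y hy
  rw [← hZ] at hx
  obtain ⟨z, hz, rfl⟩ := hx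
  exact (congrArg Subtype.val (Subgroup.mem_center_iff.mp hz ⟨y, hy⟩)).symm

/-- A `p`-group acting linearly on a nonzero space in characteristic `p` has a nonzero fixed
vector. -/
theorem exists_fixed_vector {M F V : Type*} [Group M] [Finite M] [Field F] (p : ℕ)
    [hp : Fact p.Prime] [CharP F p] [AddCommGroup V] [Module F V] (hM : IsPGroup p M)
    (ρ : Representation F M V) (v : V) (hv : v ≠ 0) (W : Submodule F V) (hvW : v ∈ W)
    (hW : ∀ g, ∀ w ∈ W, ρ g w ∈ W) :
    ∃ w ∈ W, w ≠ 0 ∧ ∀ g, ρ g w = w := by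
  let _ : Algebra (ZMod p) F := ZMod.algebra F p
  let _ : Module (ZMod p) V := Module.compHom V (algebraMap (ZMod p) F)
  have hsc : IsScalarTower (ZMod p) F V := IsScalarTower.of_compHom _ _ _
  let U : Submodule (ZMod p) V := Submodule.span (ZMod p) (Set.range fun g => ρ g v)
  have hfd : Module.Finite (ZMod p) U := Module.Finite.span_of_finite _ (Set.finite_range _)
  have hfin : Finite U := Module.finite_of_finite (ZMod p)
  have hUW : U ≤ W.restrictScalars (ZMod p) := by
    refine Submodule.span_le.mpr ?_
    rintro _ ⟨g, rfl⟩
    exact hW g v hvW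
  have hvU : v ∈ U := Submodule.subset_span ⟨1, by simp⟩
  have hstab : ∀ g, ∀ u ∈ U, ρ g u ∈ U := by
    intro g
    have : U ≤ U.comap ((ρ g).restrictScalars (ZMod p)) := by
      refine Submodule.span_le.mpr ?_
      rintro _ ⟨h, rfl⟩
      exact Submodule.subset_span ⟨g * h, by simp⟩
    exact this
  let _ : MulAction M U :=
    { smul := fun g u => ⟨ρ g u, hstab g u u.2⟩
      one_smul := fun u => Subtype.ext (by change ρ 1 u.1 = u.1; simp)
      mul_smul := fun g h u => Subtype.ext (by
        change ρ (g * h) u.1 = ρ g (ρ h u.1); simp) }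
  have hdvd : p ∣ Nat.card U := by
    have : Nontrivial U := ⟨⟨v, hvU⟩, 0, fun h => hv (congrArg Subtype.val h)⟩
    rw [Module.natCard_eq_pow_finrank (K := ZMod p), Nat.card_zmod]
    exact dvd_pow_self _ Module.finrank_pos.ne'
  obtain ⟨b, hb, hb0⟩ := hM.exists_fixed_point_of_prime_dvd_card_of_fixed_point U hdvd (a := 0)
    (fun g => Subtype.ext (map_zero (ρ g)))
  exact ⟨b, hUW b.2, fun h => hb0 (Subtype.ext h.symm), fun g => congrArg Subtype.val (hb g)⟩

/-- A normal `p`-subgroup acts trivially on a semisimple representation in characteristic `p`. -/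
theorem trivial_of_semisimple {G F V : Type*} [Group G] [Finite G] [Field F] (p : ℕ)
    [hp : Fact p.Prime] [CharP F p] [AddCommGroup V] [Module F V] (M : Subgroup G)
    (hMn : M.Normal) (hM : IsPGroup p ↥M)
    (ρ : Representation F G V) (hρ : IsSemisimpleModule (MonoidAlgebra F G) ρ.asModule) :
    ∀ g ∈ M, ∀ v : V, ρ g v = v := by
  have hss : ρ.IsSemisimpleRepresentation :=
    ρ.isSemisimpleRepresentation_iff_isSemisimpleModule_asModule.mpr hρ
  let S : Submodule F V :=
    { carrier := {v | ∀ m ∈ M, ρ m v = v}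
      zero_mem' := fun m _ => map_zero _
      add_mem' := fun ha hb m hm => by rw [map_add, ha m hm, hb m hm]
      smul_mem' := fun c a ha m hm => by rw [map_smul, ha m hm] }
  let X : Subrepresentation ρ := ⟨S, fun g v hv m hm => by
    have h1 := hv _ (hMn.conj_mem m hm g⁻¹)
    have h2 : m * g = g * (g⁻¹ * m * g⁻¹⁻¹) := by group
    rw [← Module.End.mul_apply, ← map_mul, h2, map_mul, Module.End.mul_apply, h1]⟩
  obtain ⟨Y, hXY⟩ := exists_isCompl X
  have hY : ∀ v ∈ Y.toSubmodule, v = 0 := by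
    intro v hv
    by_contra hv0
    obtain ⟨w, hwY, hw0, hw⟩ := exists_fixed_vector p hM (ρ.comp M.subtype) v hv0 Y.toSubmodule hv
      (fun g w hw => Y.apply_mem_toSubmodule g hw)
    have hwX : w ∈ X.toSubmodule := fun m hm => hw ⟨m, hm⟩
    have hle : X ⊓ Y ≤ ⊥ := hXY.disjoint.le_bot
    have : w ∈ (⊥ : Submodule F V) := hle (show w ∈ X ⊓ Y from ⟨hwX, hwY⟩)
    exact hw0 this
  intro g hg v
  have htop : (⊤ : Subrepresentation ρ) ≤ X ⊔ Y := hXY.codisjoint.top_le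
  have hv : v ∈ X.toSubmodule ⊔ Y.toSubmodule := htop (show v ∈ (⊤ : Submodule F V) from trivial)
  obtain ⟨x, hx, y, hy, rfl⟩ := Submodule.mem_sup.mp hv
  rw [hY y hy, add_zero]
  exact hx g hg

/-- `F[G]/J` as a representation on `Fin n → F`: semisimple, and any element acting trivially
satisfies `g - 1 ∈ J`. -/
theorem exists_semisimple_rep (G F : Type) [Group G] [Finite G] [Field F] :
    ∃ (n : ℕ) (ρ : Representation F G (Fin n → F)),
      IsSemisimpleModule (MonoidAlgebra F G) ρ.asModule ∧
      ∀ g, (∀ v, ρ g v = v) →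
        MonoidAlgebra.of F G g - 1 ∈ Ring.jacobson (MonoidAlgebra F G) := by
  let R := MonoidAlgebra F G
  let J := Ring.jacobson R
  have : Module.Finite F R := inferInstance
  have : IsArtinianRing R := IsArtinianRing.of_finite F R
  have hss : IsSemisimpleModule R (R ⧸ J) :=
    (IsArtinian.isSemisimpleModule_iff_jacobson R (R ⧸ J)).mpr (Module.jacobson_quotient_jacobson R R)
  let e : (R ⧸ J) ≃ₗ[F] (Fin (Module.finrank F (R ⧸ J)) → F) := (Module.finBasis F (R ⧸ J)).equivFun
  let φ : R →ₐ[F] Module.End F (Fin (Module.finrank F (R ⧸ J)) → F) :=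
    (e.conjAlgEquiv F).toAlgHom.comp (Algebra.lsmul F F (R ⧸ J))
  let ρ : Representation F G (Fin (Module.finrank F (R ⧸ J)) → F) :=
    (MonoidAlgebra.lift F _ G).symm φ
  have hφ : ρ.asAlgebraHom = φ := (MonoidAlgebra.lift F _ G).apply_symm_apply φ
  refine ⟨_, ρ, ?_, ?_⟩
  · let f : (R ⧸ J) ≃ₗ[R] ρ.asModule :=
      { (e.trans ρ.asModuleEquiv.symm).toAddEquiv with
        map_smul' := by
          intro r x
          apply ρ.asModuleEquiv.injective
          rw [RingHom.id_apply, Representation.asModuleEquiv_map_smul, hφ]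
          change e (r • x) = e (r • e.symm (e x))
          rw [e.symm_apply_apply] }
    exact f.isSemisimpleModule_iff.mp hss
  · intro g hg
    have h1 := hg (e (Submodule.Quotient.mk 1))
    have h2 : e (MonoidAlgebra.of F G g • e.symm (e (Submodule.Quotient.mk (p := J) 1))) =
      e (Submodule.Quotient.mk 1) := h1
    rw [e.symm_apply_apply] at h2
    have h3 := e.injective h2
    rw [← Submodule.Quotient.mk_smul, Submodule.Quotient.eq, smul_eq_mul, mul_one] at h3
    exact h3

/-- Let `G` be a finite group, `N ⊲ G`, and `F` a field of characteristic `p ≥ 0`.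
The following are equivalent: (1) there is a finite-dimensional semisimple
`F[G]`-module whose representation restricts to a faithful representation of `N`;
(2) `p` does not divide `|A(G) ∩ N|`; (3) `p = 0` or `N` has no nontrivial normal
`p`-subgroup. -/
theorem faithful_semisimple_on_normal_iff {G : Type} [Group G] [Finite G]
    (N : Subgroup G) (hN : N.Normal) (F : Type) [Field F] (p : ℕ) [CharP F p] :
    ((∃ (n : ℕ) (ρ : Representation F G (Fin n → F)),
        IsSemisimpleModule (MonoidAlgebra F G) ρ.asModule ∧
        ∀ g ∈ N, (∀ v : Fin n → F, ρ g v = v) → g = 1) ↔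
      ¬ (p ∣ Nat.card ↥(aSocle G ⊓ N))) ∧
    ((¬ (p ∣ Nat.card ↥(aSocle G ⊓ N))) ↔
      (p = 0 ∨ ∀ P : Subgroup ↥N, P.Normal → IsPGroup p ↥P → P = ⊥)) := by
  obtain ⟨n, ρ, hss, hρ⟩ := exists_semisimple_rep G F
  have hart : IsArtinianRing (MonoidAlgebra F G) := IsArtinianRing.of_finite F _
  rcases CharP.char_is_prime_or_zero F p with hp | rfl
  · have hpf : Fact p.Prime := ⟨hp⟩
    have h23 : (¬ (p ∣ Nat.card ↥(aSocle G ⊓ N))) ↔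
        (p = 0 ∨ ∀ P : Subgroup ↥N, P.Normal → IsPGroup p ↥P → P = ⊥) := by
      constructor
      · intro h
        right
        intro P hP hPp
        by_contra hne
        obtain ⟨M, hM, hMc, hMN, hMp⟩ := exists_minimal_of_normal N hN p P hP hPp hne
        have hle : M ≤ aSocle G ⊓ N := le_inf (le_sSup ⟨hM, hMc⟩) hMN
        refine h (dvd_trans ?_ (Subgroup.card_dvd_of_le hle))
        refine hMp.card_eq_or_dvd.resolve_left fun h1 => hM.2.1 ?_
        exact Subgroup.card_eq_one.mp h1
      · rintro (h | h) hd
        · exact hp.ne_zero h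
        · obtain ⟨P, hP, hPp, hne⟩ := exists_normal_of_dvd N p hd
          exact hne (h P hP hPp)
    refine ⟨?_, h23⟩
    rw [h23]
    constructor
    · rintro ⟨n, σ, hσ, hf⟩
      right
      intro P hP hPp
      by_contra hne
      obtain ⟨M, hM, hMc, hMN, hMp⟩ := exists_minimal_of_normal N hN p P hP hPp hne
      refine hM.2.1 ((Subgroup.eq_bot_iff_forall _).mpr fun g hg => hf g (hMN hg) ?_)
      exact trivial_of_semisimple p M hM.1 hMp σ hσ g hg
    · intro h
      replace h := h.resolve_left hp.ne_zero
      refine ⟨n, ρ, hss, ?_⟩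
      let K : Subgroup ↥N := (MonoidHom.ker ρ).comap N.subtype
      have hKp : IsPGroup p ↥K := by
        rintro ⟨⟨g, hgN⟩, hg⟩
        have hg1 : ρ g = 1 := hg
        have hmem := hρ g (fun v => by rw [hg1]; rfl)
        obtain ⟨m, hm⟩ := (IsSemiprimaryRing.isNilpotent : IsNilpotent (Ring.jacobson (MonoidAlgebra F G)))
        have h0 : (MonoidAlgebra.of F G g - 1) ^ m = 0 := by
          have := Ideal.pow_mem_pow hmem m
          rw [hm] at this
          simpa using this
        have h1 : (MonoidAlgebra.of F G g - 1) ^ p ^ m = 0 :=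
          pow_eq_zero_of_le (Nat.lt_pow_self hp.one_lt).le h0
        have hchar : CharP (MonoidAlgebra F G) p :=
          charP_of_injective_algebraMap (FaithfulSMul.algebraMap_injective F (MonoidAlgebra F G)) p
        rw [sub_pow_char_pow_of_commute _ _ (Commute.one_right _), one_pow, sub_eq_zero,
          ← map_pow] at h1
        refine ⟨m, Subtype.ext (Subtype.ext ?_)⟩
        exact MonoidAlgebra.of_injective (R := F) (h1.trans (map_one _).symm)
      have hK := h K inferInstance hKp
      intro g hg hv
      have : (⟨g, hg⟩ : N) ∈ K := LinearMap.ext hv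
      rw [hK, Subgroup.mem_bot] at this
      exact congrArg Subtype.val this
  · have h2 : ¬ (0 ∣ Nat.card ↥(aSocle G ⊓ N)) := by
      rw [zero_dvd_iff]
      exact Nat.card_pos.ne'
    have : CharZero F := CharP.charP_to_charZero F
    refine ⟨iff_of_true ⟨n, ρ, hss, fun g _ hv => ?_⟩ h2, iff_of_true h2 (Or.inl rfl)⟩
    have hmem := hρ g hv
    have : NeZero (Nat.card G : F) := ⟨Nat.cast_ne_zero.mpr Nat.card_pos.ne'⟩
    rw [IsSemisimpleRing.jacobson_eq_bot, Ideal.mem_bot, sub_eq_zero] at hmem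
    exact MonoidAlgebra.of_injective (R := F) (hmem.trans (map_one _).symm)
end
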